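/- Let k and a be integers with 2 ≤ k, 1 ≤ a ≤ k, and k ≡ a (mod 2), and let q be a complex number with |q| < 1. Then (−q; q²)_∞ (q^a, q^{2k+2−a}, q^{2k+2}; q^{2k+2})_∞ / (q²; q²)_∞ = ∑_{N_1 ≥ N_2 ≥ ⋯ ≥ N_{k−1} ≥ 0} q^{N_1² + N_2² + ⋯ + N_{k−1}² + 2N_a + 2N_{a+2} + ⋯ + 2N_{k−2}} / ((q²;q²)_{N_1−N_2} (q²;q²)_{N_2−N_3} ⋯ (q²;q²)_{N_{k−2}−N_{k−1}} (q²;q²)_{N_{k−1}}), where the sum is over all weakly decreasing (k−1)-tuples of nonnegative integers, the subscripts a, a+2, …, k−2 increase in steps of 2 (this list being empty if a = k), and the sum converges absolutely. -/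

import Mathlib

open Finset

/-- Finite q-Pochhammer symbol `(x;q)_n`. -/
noncomputable def qPoch (q x : ℂ) (n : ℕ) : ℂ :=
  ∏ j ∈ Finset.range n, (1 - x * q ^ j)

/-- Infinite q-Pochhammer symbol `(x;q)_∞`. -/
noncomputable def qPochInf (q x : ℂ) : ℂ :=
  ∏' j : ℕ, (1 - x * q ^ j)

/-- Extend a tuple `N : Fin m → ℕ` (listing `N_1, …, N_m`, 1-based) to `ℕ`, with value
`0` for indices `> m`. -/
def ext (m : ℕ) (N : Fin m → ℕ) (i : ℕ) : ℕ :=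
  if h : i - 1 < m then N ⟨i - 1, h⟩ else 0

/-- Summand of Andrews' multisum when `k ≡ a (mod 2)`: the exponent is
`N_1² + ⋯ + N_{k-1}² + 2N_a + 2N_{a+2} + ⋯ + 2N_{k-2}` and the denominator is
`(q²;q²)_{N_1-N_2} ⋯ (q²;q²)_{N_{k-2}-N_{k-1}} (q²;q²)_{N_{k-1}}`. -/
noncomputable def andrewsTerm (k a : ℕ) (q : ℂ) (N : Fin (k - 1) → ℕ) : ℂ :=
  q ^ ((∑ i ∈ Finset.Icc 1 (k - 1), (ext (k - 1) N i) ^ 2) +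
        ∑ i ∈ (Finset.Icc a (k - 2)).filter (fun i => i % 2 = a % 2),
          2 * ext (k - 1) N i) /
    ∏ i ∈ Finset.Icc 1 (k - 1), qPoch (q ^ 2) (q ^ 2) (ext (k - 1) N i - ext (k - 1) N (i + 1))

open Filter Topology

lemma qPoch_zero (q x : ℂ) : qPoch q x 0 = 1 := by simp [qPoch]

lemma qPoch_succ (q x : ℂ) (n : ℕ) : qPoch q x (n + 1) = qPoch q x n * (1 - x * q ^ n) :=
  Finset.prod_range_succ _ _

lemma qPoch_add (q x : ℂ) (m n : ℕ) :
    qPoch q x (m + n) = qPoch q x m * qPoch q (x * q ^ m) n := by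
  simp only [qPoch, Finset.prod_range_add]
  congr 1
  exact Finset.prod_congr rfl fun j _ => by ring

lemma qPoch_succ_left (q x : ℂ) (n : ℕ) :
    qPoch q x (n + 1) = (1 - x) * qPoch q (x * q) n := by
  rw [add_comm, qPoch_add]
  simp [qPoch]

lemma one_sub_pow_ne_zero {q : ℂ} (hq : ‖q‖ < 1) (n : ℕ) : 1 - q ^ (n + 1) ≠ 0 := by
  intro h
  have h1 : ‖q ^ (n + 1)‖ = 1 := by rw [← sub_eq_zero.mp h]; simp
  rw [norm_pow] at h1
  exact (pow_lt_one₀ (norm_nonneg q) hq n.succ_ne_zero).ne h1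

lemma qPoch_self_ne_zero {q : ℂ} (hq : ‖q‖ < 1) (n : ℕ) : qPoch q q n ≠ 0 :=
  Finset.prod_ne_zero_iff.mpr fun j _ => by
    rw [← pow_succ']
    exact one_sub_pow_ne_zero hq j

lemma summable_norm_neg_mul_pow {q : ℂ} (hq : ‖q‖ < 1) (x : ℂ) :
    Summable fun j : ℕ => ‖-(x * q ^ j)‖ := by
  simp only [norm_neg, norm_mul, norm_pow]
  exact (summable_geometric_of_lt_one (norm_nonneg q) hq).mul_left _

lemma tendsto_qPoch {q : ℂ} (hq : ‖q‖ < 1) (x : ℂ) :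
    Tendsto (qPoch q x) atTop (𝓝 (qPochInf q x)) := by
  have h := (multipliable_one_add_of_summable
    (summable_norm_neg_mul_pow hq x)).tendsto_prod_tprod_nat
  simp only [← sub_eq_add_neg] at h
  exact h

lemma qPochInf_self_ne_zero {q : ℂ} (hq : ‖q‖ < 1) : qPochInf q q ≠ 0 := by
  have h := tprod_one_add_ne_zero_of_summable (f := fun j : ℕ => -(q * q ^ j))
    (fun j => by
      rw [← sub_eq_add_neg, ← pow_succ']
      exact one_sub_pow_ne_zero hq j) (summable_norm_neg_mul_pow hq q)
  simp only [← sub_eq_add_neg] at h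
  exact h

/-- The Gaussian binomial coefficient, defined by the `q`-Pascal recurrence. -/
noncomputable def gaussBinom (q : ℂ) : ℕ → ℕ → ℂ
  | _, 0 => 1
  | 0, _ + 1 => 0
  | m + 1, r + 1 => gaussBinom q m (r + 1) + q ^ (m - r) * gaussBinom q m r

lemma gaussBinom_zero_right (q : ℂ) (m : ℕ) : gaussBinom q m 0 = 1 := by
  cases m <;> rfl

lemma gaussBinom_eq_zero (q : ℂ) {m r : ℕ} (h : m < r) : gaussBinom q m r = 0 := by
  induction m generalizing r with
  | zero => obtain ⟨r, rfl⟩ := Nat.exists_eq_succ_of_ne_zero h.ne'; rfl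
  | succ m ih =>
    obtain ⟨r, rfl⟩ := Nat.exists_eq_succ_of_ne_zero (Nat.ne_zero_of_lt h)
    simp [gaussBinom, ih (show m < r + 1 by omega), ih (show m < r by omega)]

lemma gaussBinom_mul_qPoch (q : ℂ) (r t : ℕ) :
    gaussBinom q (r + t) r * (qPoch q q r * qPoch q q t) = qPoch q q (r + t) := by
  induction hm : r + t generalizing r t with
  | zero =>
    obtain ⟨rfl, rfl⟩ : r = 0 ∧ t = 0 := by omega
    simp [gaussBinom, qPoch_zero]
  | succ m ih =>
    rcases r with _ | r
    · obtain rfl : t = m + 1 := by omega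
      simp [gaussBinom, qPoch_zero]
    obtain rfl : m = r + t := by omega
    have h2 := ih r t rfl
    rcases t with _ | t
    · simp only [gaussBinom, add_zero, gaussBinom_eq_zero q (Nat.lt_succ_self r), qPoch_zero,
        qPoch_succ, Nat.sub_self] at h2 ⊢
      linear_combination (1 - q * q ^ r) * h2
    · have h1 := ih (r + 1) t (by omega)
      simp only [gaussBinom, Nat.add_sub_cancel_left, qPoch_succ q q r, qPoch_succ q q t,
        qPoch_succ q q (r + (t + 1))] at h1 h2 ⊢
      linear_combination (1 - q * q ^ t) * h1 + q ^ (t + 1) * (1 - q * q ^ r) * h2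

/-- The `q`-Chu–Vandermonde summation in polynomial form, in base `p ^ 2`. -/
lemma qChuVandermonde (p b d : ℂ) (m : ℕ) :
    ∑ r ∈ Finset.range (m + 1), gaussBinom (p ^ 2) m r * ((-d) ^ r * p ^ (r ^ 2)) *
        qPoch (p ^ 2) b r * qPoch (p ^ 2) (b * d * p * (p ^ 2) ^ r) (m - r) =
      qPoch (p ^ 2) (d * p) m := by
  induction m generalizing b with
  | zero => simp [gaussBinom, qPoch_zero]
  | succ m ih =>
    have key : ∑ r ∈ Finset.range (m + 1 + 1), gaussBinom (p ^ 2) (m + 1) r *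
          ((-d) ^ r * p ^ (r ^ 2)) * qPoch (p ^ 2) b r *
          qPoch (p ^ 2) (b * d * p * (p ^ 2) ^ r) (m + 1 - r) =
        ∑ r ∈ Finset.range (m + 1 + 1), gaussBinom (p ^ 2) m r *
          ((-d) ^ r * p ^ (r ^ 2)) * qPoch (p ^ 2) b r *
          qPoch (p ^ 2) (b * d * p * (p ^ 2) ^ r) (m + 1 - r) +
        ∑ r ∈ Finset.range (m + 1), (p ^ 2) ^ (m - r) * gaussBinom (p ^ 2) m r *
          ((-d) ^ (r + 1) * p ^ ((r + 1) ^ 2)) * qPoch (p ^ 2) b (r + 1) *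
          qPoch (p ^ 2) (b * d * p * (p ^ 2) ^ (r + 1)) (m - r) := by
      rw [Finset.sum_range_succ', Finset.sum_range_succ' _ (m + 1), add_right_comm,
        ← Finset.sum_add_distrib]
      congr 1
      · refine Finset.sum_congr rfl fun r _ => ?_
        simp only [gaussBinom, Nat.add_sub_add_right]
        ring
      · simp [gaussBinom_zero_right]
    have e1 : ∑ r ∈ Finset.range (m + 1 + 1), gaussBinom (p ^ 2) m r *
          ((-d) ^ r * p ^ (r ^ 2)) * qPoch (p ^ 2) b r *
          qPoch (p ^ 2) (b * d * p * (p ^ 2) ^ r) (m + 1 - r) =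
        (1 - b * d * p * (p ^ 2) ^ m) * qPoch (p ^ 2) (d * p) m := by
      rw [Finset.sum_range_succ, gaussBinom_eq_zero _ (Nat.lt_succ_self m), ← ih b,
        Finset.mul_sum]
      simp only [zero_mul, add_zero]
      refine Finset.sum_congr rfl fun r hr => ?_
      obtain ⟨t, rfl⟩ := Nat.exists_eq_add_of_le (Nat.lt_succ_iff.mp (Finset.mem_range.mp hr))
      rw [show r + t + 1 - r = t + 1 by omega, Nat.add_sub_cancel_left, qPoch_succ]
      ring
    have e2 : ∑ r ∈ Finset.range (m + 1), (p ^ 2) ^ (m - r) * gaussBinom (p ^ 2) m r *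
          ((-d) ^ (r + 1) * p ^ ((r + 1) ^ 2)) * qPoch (p ^ 2) b (r + 1) *
          qPoch (p ^ 2) (b * d * p * (p ^ 2) ^ (r + 1)) (m - r) =
        -(d * p * (p ^ 2) ^ m * (1 - b)) * qPoch (p ^ 2) (d * p) m := by
      rw [← ih (b * p ^ 2), Finset.mul_sum]
      refine Finset.sum_congr rfl fun r hr => ?_
      obtain ⟨t, rfl⟩ := Nat.exists_eq_add_of_le (Nat.lt_succ_iff.mp (Finset.mem_range.mp hr))
      rw [Nat.add_sub_cancel_left, qPoch_succ_left,
        show b * p ^ 2 * d * p * (p ^ 2) ^ r = b * d * p * (p ^ 2) ^ (r + 1) by ring]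
      ring
    rw [key, e1, e2, qPoch_succ]
    ring

/-- `1 / (q;q)_m` for an integer `m`, with the convention that it vanishes for `m < 0`. -/
noncomputable def invPoch (q : ℂ) (m : ℤ) : ℂ :=
  if 0 ≤ m then (qPoch q q m.toNat)⁻¹ else 0

lemma invPoch_natCast (q : ℂ) (m : ℕ) : invPoch q m = (qPoch q q m)⁻¹ := by
  simp [invPoch]

lemma invPoch_of_neg (q : ℂ) {m : ℤ} (hm : m < 0) : invPoch q m = 0 := by
  simp [invPoch, hm]

lemma invPoch_sub_one {q : ℂ} (hq : ‖q‖ < 1) (m : ℤ) :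
    invPoch q (m - 1) = (1 - q ^ m) * invPoch q m := by
  rcases lt_trichotomy m 0 with hm | rfl | hm
  · rw [invPoch_of_neg q hm, invPoch_of_neg q (by omega), mul_zero]
  · rw [invPoch_of_neg q (by omega)]; simp
  · obtain ⟨n, rfl⟩ : ∃ n : ℕ, m = ((n + 1 : ℕ) : ℤ) := ⟨(m - 1).toNat, by omega⟩
    rw [show ((n + 1 : ℕ) : ℤ) - 1 = (n : ℤ) by push_cast; ring, invPoch_natCast,
      invPoch_natCast, qPoch_succ, zpow_natCast, ← pow_succ', mul_inv]
    field_simp [one_sub_pow_ne_zero hq n]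

lemma tendsto_invPoch_natCast {q : ℂ} (hq : ‖q‖ < 1) :
    Tendsto (fun n : ℕ => invPoch q n) atTop (𝓝 (qPochInf q q)⁻¹) := by
  simp only [invPoch_natCast]
  exact (tendsto_qPoch hq q).inv₀ (qPochInf_self_ne_zero hq)

lemma tendsto_invPoch_add {q : ℂ} (hq : ‖q‖ < 1) (c : ℤ) :
    Tendsto (fun n : ℕ => invPoch q (n + c)) atTop (𝓝 (qPochInf q q)⁻¹) := by
  have h1 : Tendsto (fun n : ℕ => ((n : ℤ) + c).toNat) atTop atTop :=
    tendsto_atTop.mpr fun b => eventually_atTop.mpr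
      ⟨b + c.natAbs, fun n hn => by omega⟩
  refine ((tendsto_invPoch_natCast hq).comp h1).congr' ?_
  filter_upwards [eventually_ge_atTop c.natAbs] with n hn
  simp only [Function.comp]
  rw [Int.toNat_of_nonneg (by omega)]

lemma exists_norm_le_of_tendsto {u : ℕ → ℂ} {l : ℂ} (h : Tendsto u atTop (𝓝 l)) :
    ∃ K : ℝ, 0 ≤ K ∧ ∀ n, ‖u n‖ ≤ K := by
  obtain ⟨K, hK⟩ := (Metric.isBounded_range_of_tendsto u h).exists_norm_le
  exact ⟨K, (norm_nonneg _).trans (hK (u 0) ⟨0, rfl⟩), fun n => hK _ ⟨n, rfl⟩⟩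

lemma exists_norm_invPoch_le {q : ℂ} (hq : ‖q‖ < 1) :
    ∃ K : ℝ, 0 ≤ K ∧ ∀ m, ‖invPoch q m‖ ≤ K := by
  obtain ⟨K, hK0, hK⟩ := exists_norm_le_of_tendsto (tendsto_invPoch_natCast hq)
  refine ⟨K, hK0, fun m => ?_⟩
  rcases lt_or_ge m 0 with hm | hm
  · simpa [invPoch_of_neg q hm] using hK0
  · lift m to ℕ using hm
    exact hK m

lemma qPoch_div_pow {p z : ℂ} (hp : p ≠ 0) (hz : z ≠ 0) (n : ℕ) :
    qPoch (p ^ 2) (z / (p ^ 2) ^ n) n * ((-1) ^ n * z⁻¹ ^ n * p ^ (n ^ 2 + n)) =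
      qPoch (p ^ 2) (p ^ 2 / z) n := by
  induction n with
  | zero => simp [qPoch_zero]
  | succ n ih =>
    have hfac : (1 - z / (p ^ 2) ^ (n + 1)) * (-z⁻¹ * p ^ (2 * n + 2)) =
        1 - p ^ 2 / z * (p ^ 2) ^ n := by
      field_simp
      ring
    rw [qPoch_succ_left, qPoch_succ, ← ih, ← hfac,
      show z / (p ^ 2) ^ (n + 1) * p ^ 2 = z / (p ^ 2) ^ n by rw [pow_succ]; field_simp]
    ring

lemma triple_product_monomial {p z : ℂ} (hp : p ≠ 0) (hz : z ≠ 0) (r n : ℕ) :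
    (-1 : ℂ) ^ ((r : ℤ) - n) * z ^ ((r : ℤ) - n) * p ^ (((r : ℤ) - n) ^ 2 - ((r : ℤ) - n)) =
      (-(z / p ^ (2 * n + 1))) ^ r * p ^ (r ^ 2) * ((-1) ^ n * z⁻¹ ^ n * p ^ (n ^ 2 + n)) := by
  rw [show ((r : ℤ) - n) ^ 2 - ((r : ℤ) - n) =
      ((r ^ 2 + (n ^ 2 + n) : ℕ) : ℤ) - (((2 * n + 1) * r : ℕ) : ℤ) by push_cast; ring,
    zpow_sub₀ hp, zpow_sub₀ hz, zpow_sub₀ (by norm_num : (-1 : ℂ) ≠ 0)]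
  simp only [zpow_natCast]
  rw [neg_pow (z / p ^ (2 * n + 1)), div_pow, ← pow_mul, pow_add, inv_pow, div_eq_mul_inv
    ((-1 : ℂ) ^ r), ← inv_pow, show (-1 : ℂ)⁻¹ = -1 by norm_num]
  ring

lemma tsum_int_eq_sum_range (f : ℤ → ℂ) (n : ℕ) (hf : ∀ j : ℤ, (n : ℤ) < |j| → f j = 0) :
    ∑' j, f j = ∑ r ∈ Finset.range (2 * n + 1), f ((r : ℤ) - n) := by
  have hinj : Function.Injective fun r : ℕ => (r : ℤ) - n := fun x y h => by
    simp only [sub_left_inj, Nat.cast_inj] at h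
    exact h
  rw [tsum_eq_sum (s := (Finset.range (2 * n + 1)).image fun r : ℕ => (r : ℤ) - n),
    Finset.sum_image hinj.injOn]
  intro j hj
  refine hf j ?_
  by_contra h
  rw [not_lt, abs_le] at h
  exact hj (Finset.mem_image.mpr ⟨(j + n).toNat, Finset.mem_range.mpr (by omega), by omega⟩)

lemma invPoch_mul_invPoch_eq_zero (q : ℂ) {n : ℕ} {j : ℤ} (hj : (n : ℤ) < |j|) :
    invPoch q (n - j) * invPoch q (n + j) = 0 := by
  rcases lt_abs.mp hj with h | h
  · rw [invPoch_of_neg q (show (n : ℤ) - j < 0 by omega), zero_mul]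
  · rw [invPoch_of_neg q (show (n : ℤ) + j < 0 by omega), mul_zero]

/-- The finite form of the Jacobi triple product identity, in base `p ^ 2`. -/
lemma finite_jacobi_triple_product {p z : ℂ} (hp : p ≠ 0) (hp1 : ‖p ^ 2‖ < 1) (hz : z ≠ 0)
    (n : ℕ) :
    ∑' j : ℤ, (-1) ^ j * z ^ j * p ^ (j ^ 2 - j) *
        (invPoch (p ^ 2) (n - j) * invPoch (p ^ 2) (n + j)) =
      qPoch (p ^ 2) z n * qPoch (p ^ 2) (p ^ 2 / z) n * invPoch (p ^ 2) (2 * n : ℕ) := by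
  rw [tsum_int_eq_sum_range _ n fun j hj => by
    rw [invPoch_mul_invPoch_eq_zero _ hj, mul_zero]]
  have hcv := qChuVandermonde p 0 (z / p ^ (2 * n + 1)) (2 * n)
  have h0 : ∀ m, qPoch (p ^ 2) 0 m = 1 := fun m => by simp [qPoch]
  simp only [zero_mul, h0, mul_one] at hcv
  rw [show z / p ^ (2 * n + 1) * p = z / (p ^ 2) ^ n by field_simp; ring, two_mul, qPoch_add,
    div_mul_cancel₀ z (pow_ne_zero _ (pow_ne_zero _ hp))] at hcv
  rw [← qPoch_div_pow hp hz, show ∀ x y u v : ℂ, x * (y * u) * v = y * x * (u * v) by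
    intros; ring, ← hcv, Finset.sum_mul, two_mul]
  refine Finset.sum_congr rfl fun r hr => ?_
  obtain ⟨t, ht⟩ := Nat.exists_eq_add_of_le (Nat.lt_succ_iff.mp (Finset.mem_range.mp hr))
  have hg := gaussBinom_mul_qPoch (p ^ 2) r t
  rw [← ht] at hg
  rw [show (n : ℤ) - (r - n) = (t : ℤ) by omega, show (n : ℤ) + (r - n) = (r : ℤ) by ring,
    invPoch_natCast, invPoch_natCast, invPoch_natCast, ← hg]
  rw [triple_product_monomial hp hz, ← two_mul]
  have h1 := qPoch_self_ne_zero hp1 r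
  have h2 := qPoch_self_ne_zero hp1 t
  have h3 : gaussBinom (p ^ 2) (n + n) r ≠ 0 := fun h => by
    rw [h, zero_mul] at hg
    exact qPoch_self_ne_zero hp1 _ hg.symm
  rw [← two_mul] at h3
  generalize gaussBinom (p ^ 2) (2 * n) r = g at *
  generalize qPoch (p ^ 2) (p ^ 2) r = x at *
  generalize qPoch (p ^ 2) (p ^ 2) t = y at *
  rw [mul_inv, mul_inv]
  have : g * g⁻¹ = 1 := mul_inv_cancel₀ h3
  linear_combination (-((-(z / p ^ (2 * n + 1))) ^ r * p ^ (r ^ 2) *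
    ((-1) ^ n * z⁻¹ ^ n * p ^ (n ^ 2 + n))) * x⁻¹ * y⁻¹) * this

lemma tendsto_tsum_mul_invPoch {q : ℂ} (hq : ‖q‖ < 1) {x : ℤ → ℂ}
    (hx : Summable fun j => ‖x j‖) :
    Tendsto (fun n : ℕ => ∑' j : ℤ, x j * (invPoch q (n - j) * invPoch q (n + j))) atTop
      (𝓝 ((∑' j, x j) * ((qPochInf q q)⁻¹ * (qPochInf q q)⁻¹))) := by
  obtain ⟨K, hK0, hK⟩ := exists_norm_invPoch_le hq
  rw [← tsum_mul_right]
  refine tendsto_tsum_of_dominated_convergence (hx.mul_right (K * K)) (fun j => ?_)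
    (Eventually.of_forall fun n j => ?_)
  · have h := tendsto_invPoch_add hq (-j)
    simp only [← sub_eq_add_neg] at h
    exact (h.mul (tendsto_invPoch_add hq j)).const_mul _
  · rw [norm_mul, norm_mul]
    gcongr <;> apply hK

/-- The Jacobi triple product identity, in base `p ^ 2`. -/
lemma jacobi_triple_product {p z : ℂ} (hp : p ≠ 0) (hp1 : ‖p ^ 2‖ < 1) (hz : z ≠ 0)
    (hs : Summable fun j : ℤ => ‖(-1) ^ j * z ^ j * p ^ (j ^ 2 - j)‖) :
    ∑' j : ℤ, (-1) ^ j * z ^ j * p ^ (j ^ 2 - j) =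
      qPochInf (p ^ 2) z * qPochInf (p ^ 2) (p ^ 2 / z) * qPochInf (p ^ 2) (p ^ 2) := by
  have h1 := tendsto_tsum_mul_invPoch hp1 hs
  simp only [finite_jacobi_triple_product hp hp1 hz] at h1
  have h2 : Tendsto (fun n : ℕ => 2 * n) atTop atTop :=
    tendsto_id.const_mul_atTop' (by norm_num)
  have h3 := ((tendsto_qPoch hp1 z).mul (tendsto_qPoch hp1 (p ^ 2 / z))).mul
    ((tendsto_invPoch_natCast hp1).comp h2)
  have h4 := tendsto_nhds_unique h1 h3
  have h5 := qPochInf_self_ne_zero hp1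
  field_simp at h4
  linear_combination h4

/-- The kernel `(-q;q²)_n / ((q²;q²)_{n-j} (q²;q²)_{n+j})`. -/
noncomputable def baileyKernel (q : ℂ) (n : ℕ) (j : ℤ) : ℂ :=
  qPoch (q ^ 2) (-q) n * (invPoch (q ^ 2) (n - j) * invPoch (q ^ 2) (n + j))

lemma baileyKernel_neg (q : ℂ) (n : ℕ) (j : ℤ) : baileyKernel q n (-j) = baileyKernel q n j := by
  rw [baileyKernel, baileyKernel, sub_neg_eq_add, ← sub_eq_add_neg, mul_comm (invPoch _ (n + j))]

lemma baileyKernel_eq_zero (q : ℂ) {n : ℕ} {j : ℤ} (hj : (n : ℤ) < |j|) :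
    baileyKernel q n j = 0 := by
  rw [baileyKernel, invPoch_mul_invPoch_eq_zero _ hj, mul_zero]

lemma sum_invPoch_mul_baileyKernel_natCast {q : ℂ} (hq : ‖q ^ 2‖ < 1) (n j : ℕ) :
    ∑ s ∈ Finset.range (n + 1), invPoch (q ^ 2) (n - s) * q ^ (s ^ 2) * baileyKernel q s j =
      q ^ (j ^ 2) * baileyKernel q n j := by
  rcases lt_or_ge n j with hnj | hnj
  · rw [baileyKernel_eq_zero q (by simpa using hnj), mul_zero]
    refine Finset.sum_eq_zero fun s hs => ?_
    rw [Finset.mem_range] at hs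
    rw [baileyKernel_eq_zero q (by rw [Nat.abs_cast]; omega), mul_zero]
  obtain ⟨m, rfl⟩ := Nat.exists_eq_add_of_le hnj
  rw [add_assoc, Finset.sum_range_add, Finset.sum_eq_zero fun s hs => ?_, zero_add]
  swap
  · rw [Finset.mem_range] at hs
    rw [baileyKernel_eq_zero q (by rw [Nat.abs_cast]; omega), mul_zero]
  have hne := qPoch_self_ne_zero hq
  have hcv := qChuVandermonde q (-q * (q ^ 2) ^ j) (-(q ^ 2) ^ j) m
  rw [show -(q ^ 2) ^ j * q = -q * (q ^ 2) ^ j by ring] at hcv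
  have key : q ^ (j ^ 2) * baileyKernel q (j + m) j =
      q ^ (j ^ 2) * qPoch (q ^ 2) (-q) j * qPoch (q ^ 2) (-q * (q ^ 2) ^ j) m *
        ((qPoch (q ^ 2) (q ^ 2) m)⁻¹ * (qPoch (q ^ 2) (q ^ 2) (2 * j + m))⁻¹) := by
    rw [baileyKernel, qPoch_add, show ((j + m : ℕ) : ℤ) - j = (m : ℤ) by push_cast; ring,
      show ((j + m : ℕ) : ℤ) + j = ((2 * j + m : ℕ) : ℤ) by push_cast; ring, invPoch_natCast,
      invPoch_natCast]
    ring
  rw [key, ← hcv, Finset.mul_sum, Finset.sum_mul]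
  refine Finset.sum_congr rfl fun r hr => ?_
  obtain ⟨t, rfl⟩ := Nat.exists_eq_add_of_le (Nat.lt_succ_iff.mp (Finset.mem_range.mp hr))
  have hg := gaussBinom_mul_qPoch (q ^ 2) r t
  rw [baileyKernel, qPoch_add, show ((j + r : ℕ) : ℤ) - j = (r : ℤ) by push_cast; ring,
    show ((j + r : ℕ) : ℤ) + j = ((2 * j + r : ℕ) : ℤ) by push_cast; ring,
    show ((j + (r + t) : ℕ) : ℤ) - (j + r : ℕ) = (t : ℤ) by push_cast; ring,
    invPoch_natCast, invPoch_natCast, invPoch_natCast, Nat.add_sub_cancel_left,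
    ← add_assoc (2 * j), qPoch_add _ _ (2 * j + r) t,
    show -q * (q ^ 2) ^ j * -(q ^ 2) ^ j * q * (q ^ 2) ^ r = q ^ 2 * (q ^ 2) ^ (2 * j + r) by ring,
    neg_neg]
  have h1 := hne (2 * j + r + t)
  rw [qPoch_add] at h1
  have h2 := right_ne_zero_of_mul h1
  have h3 := left_ne_zero_of_mul h1
  have h4 := hne (r + t)
  have h5 := hne r
  have h6 := hne t
  field_simp
  rw [← hg]
  ring

lemma sum_invPoch_mul_baileyKernel {q : ℂ} (hq : ‖q ^ 2‖ < 1) (n : ℕ) (j : ℤ) :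
    ∑ s ∈ Finset.range (n + 1), invPoch (q ^ 2) (n - s) * q ^ (s ^ 2) * baileyKernel q s j =
      q ^ (j ^ 2) * baileyKernel q n j := by
  obtain ⟨i, rfl | rfl⟩ := j.eq_nat_or_neg
  · exact_mod_cast sum_invPoch_mul_baileyKernel_natCast hq n i
  · simp only [baileyKernel_neg, neg_sq]
    exact_mod_cast sum_invPoch_mul_baileyKernel_natCast hq n i

/-- The alternating theta-type sum `∑_j (-1)^j q^{A j² - B j} K_n(j)` against the Bailey kernel. -/
noncomputable def thetaSum (q : ℂ) (A B : ℤ) (n : ℕ) : ℂ :=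
  ∑' j : ℤ, (-1) ^ j * q ^ (A * j ^ 2 - B * j) * baileyKernel q n j

lemma summable_mul_baileyKernel (q : ℂ) (f : ℤ → ℂ) (n : ℕ) :
    Summable fun j => f j * baileyKernel q n j :=
  summable_of_ne_finset_zero (s := Finset.Icc (-n : ℤ) n) fun j hj => by
    rw [baileyKernel_eq_zero q, mul_zero]
    by_contra h
    exact hj (Finset.mem_Icc.mpr (abs_le.mp (not_lt.mp h)))

lemma sum_invPoch_mul_thetaSum {q : ℂ} (hq0 : q ≠ 0) (hq : ‖q ^ 2‖ < 1) (A B : ℤ) (n : ℕ) :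
    ∑ s ∈ Finset.range (n + 1), invPoch (q ^ 2) (n - s) * q ^ (s ^ 2) * thetaSum q A B s =
      thetaSum q (A + 1) B n := by
  simp only [thetaSum, ← tsum_mul_left]
  rw [← Summable.tsum_finsetSum fun s _ => (summable_mul_baileyKernel q _ s).mul_left _]
  refine tsum_congr fun j => ?_
  have h := sum_invPoch_mul_baileyKernel hq n j
  rw [show (A + 1) * j ^ 2 - B * j = (A * j ^ 2 - B * j) + j ^ 2 by ring, zpow_add₀ hq0,
    ← mul_assoc, mul_assoc _ (q ^ (j ^ 2)), ← h, Finset.mul_sum]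
  exact Finset.sum_congr rfl fun s _ => by ring

lemma pow_mul_thetaSum {q : ℂ} (hq0 : q ≠ 0) (hq : ‖q ^ 2‖ < 1) (A : ℤ) (n : ℕ) :
    q ^ (2 * n) * thetaSum q A (A - 2) n = thetaSum q A A n := by
  set u : ℤ → ℂ := fun j => (-1) ^ j * q ^ (A * j ^ 2 - A * j) * (q ^ (2 * (n + j)) - 1) *
    baileyKernel q n j with hu
  have hdiff : q ^ (2 * n) * thetaSum q A (A - 2) n - thetaSum q A A n = ∑' j, u j := by
    rw [thetaSum, thetaSum, ← tsum_mul_left, ← Summable.tsum_sub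
      ((summable_mul_baileyKernel q _ n).mul_left _) (summable_mul_baileyKernel q _ n)]
    refine tsum_congr fun j => ?_
    rw [hu]
    dsimp only
    rw [show A * j ^ 2 - (A - 2) * j = (A * j ^ 2 - A * j) + 2 * j by ring, zpow_add₀ hq0,
      mul_add, zpow_add₀ hq0, ← zpow_natCast]
    push_cast
    ring
  have hK : ∀ j : ℤ, (q ^ (2 * (n + j)) - 1) * baileyKernel q n j =
      -(qPoch (q ^ 2) (-q) n * (invPoch (q ^ 2) (n - j) * invPoch (q ^ 2) (n + j - 1))) := by
    intro j
    rw [invPoch_sub_one hq, baileyKernel, zpow_mul]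
    norm_cast
    ring
  have hanti : ∀ j, u (1 - j) = -u j := by
    intro j
    simp only [hu, mul_assoc]
    rw [hK, hK, show (n : ℤ) - (1 - j) = n + j - 1 by ring,
      show (n : ℤ) + (1 - j) - 1 = n - j by ring,
      show A * (1 - j) ^ 2 - A * (1 - j) = A * j ^ 2 - A * j by ring,
      zpow_sub₀ (by norm_num : (-1 : ℂ) ≠ 0), zpow_one, div_eq_mul_inv, ← inv_zpow,
      show (-1 : ℂ)⁻¹ = -1 by norm_num]
    ring
  have hz := (Equiv.subLeft (1 : ℤ)).tsum_eq u
  simp only [Equiv.subLeft_apply, hanti, tsum_neg] at hz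
  rw [← sub_eq_zero, hdiff]
  exact self_eq_neg.mp hz.symm

lemma thetaSum_one_one {q : ℂ} (hq0 : q ≠ 0) (hq : ‖q ^ 2‖ < 1) (n : ℕ) :
    thetaSum q 1 1 n = if n = 0 then 1 else 0 := by
  have h := finite_jacobi_triple_product hq0 hq one_ne_zero n
  have h1 : thetaSum q 1 1 n = qPoch (q ^ 2) (-q) n * (qPoch (q ^ 2) 1 n *
      qPoch (q ^ 2) (q ^ 2 / 1) n * invPoch (q ^ 2) (2 * n : ℕ)) := by
    rw [← h, thetaSum, ← tsum_mul_left]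
    refine tsum_congr fun j => ?_
    rw [baileyKernel, one_zpow, one_mul, one_mul]
    ring
  rw [h1]
  rcases n with _ | n
  · simp [qPoch_zero, invPoch]
  · simp [qPoch_succ_left (q ^ 2) 1]

lemma thetaSum_two_one {q : ℂ} (hq0 : q ≠ 0) (hq : ‖q ^ 2‖ < 1) (n : ℕ) :
    thetaSum q 2 1 n = invPoch (q ^ 2) n := by
  rw [← one_add_one_eq_two, ← sum_invPoch_mul_thetaSum hq0 hq]
  simp [thetaSum_one_one hq0 hq]

lemma tendsto_thetaSum {q : ℂ} (hq : ‖q ^ 2‖ < 1) (A B : ℤ)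
    (hs : Summable fun j : ℤ => ‖(-1) ^ j * q ^ (A * j ^ 2 - B * j)‖) :
    Tendsto (thetaSum q A B) atTop (𝓝 (qPochInf (q ^ 2) (-q) *
      ((∑' j : ℤ, (-1) ^ j * q ^ (A * j ^ 2 - B * j)) *
        ((qPochInf (q ^ 2) (q ^ 2))⁻¹ * (qPochInf (q ^ 2) (q ^ 2))⁻¹)))) := by
  refine ((tendsto_qPoch hq (-q)).mul (tendsto_tsum_mul_invPoch hq hs)).congr fun n => ?_
  rw [thetaSum, ← tsum_mul_left]
  refine tsum_congr fun j => ?_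
  rw [baileyKernel]
  ring

lemma ext_succ_of_lt {m : ℕ} (N : Fin m → ℕ) {i : ℕ} (h : i < m) : ext m N (i + 1) = N ⟨i, h⟩ := by
  simp [_root_.ext, h]

lemma ext_succ_of_le {m : ℕ} (N : Fin m → ℕ) {i : ℕ} (h : m ≤ i) : ext m N (i + 1) = 0 := by
  simp [_root_.ext, h]

lemma ext_cons_one {m : ℕ} (s : ℕ) (N : Fin m → ℕ) :
    ext (m + 1) (Fin.cons s N : Fin (m + 1) → ℕ) 1 = s := by
  simp [_root_.ext]

lemma ext_cons_add_two {m : ℕ} (s : ℕ) (N : Fin m → ℕ) (i : ℕ) :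
    ext (m + 1) (Fin.cons s N : Fin (m + 1) → ℕ) (i + 2) = ext m N (i + 1) := by
  rcases lt_or_ge i m with h | h
  · rw [ext_succ_of_lt N h, ext_succ_of_lt _ (Nat.succ_lt_succ h)]
    exact Fin.cons_succ (α := fun _ => ℕ) s N ⟨i, h⟩
  · rw [ext_succ_of_le N h, ext_succ_of_le _ (Nat.succ_le_succ h)]

/-- The summand of a multisum with weights `w` along a chain `N_1, …, N_m, 0`; it vanishes unless
the chain is weakly decreasing. -/
noncomputable def chainTerm (q : ℂ) (m : ℕ) (w : ℕ → ℕ → ℂ) (N : Fin m → ℕ) : ℂ :=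
  ∏ i ∈ Finset.range m, (w i (ext m N (i + 1)) *
    invPoch q ((ext m N (i + 1) : ℤ) - ext m N (i + 2)))

lemma chainTerm_cons (q : ℂ) (m : ℕ) (w : ℕ → ℕ → ℂ) (s : ℕ) (N : Fin m → ℕ) :
    chainTerm q (m + 1) w (Fin.cons s N : Fin (m + 1) → ℕ) =
      w 0 s * (invPoch q ((s : ℤ) - ext m N 1) * chainTerm q m (fun i => w (i + 1)) N) := by
  rw [chainTerm, Finset.prod_range_succ']
  simp only [zero_add, ext_cons_one, ext_cons_add_two, chainTerm]
  exact (mul_comm _ _).trans (mul_assoc _ _ _)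

lemma antitone_of_chainTerm_ne_zero {q : ℂ} {m : ℕ} {w : ℕ → ℕ → ℂ} {N : Fin m → ℕ}
    (h : chainTerm q m w N ≠ 0) : Antitone N := by
  have hanti : Antitone fun i => ext m N (i + 1) := antitone_nat_of_succ_le fun i => by
    rcases lt_or_ge i m with hi | hi
    · by_contra hlt
      refine Finset.prod_ne_zero_iff.mp h i (Finset.mem_range.mpr hi) ?_
      rw [invPoch_of_neg q (sub_neg_of_lt (Nat.cast_lt.mpr (not_le.mp hlt))), mul_zero]
    · rw [ext_succ_of_le N (Nat.le_succ_of_le hi)]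
      exact Nat.zero_le _
  intro i j hij
  have h1 := hanti (show (i : ℕ) ≤ j from hij)
  simpa only [ext_succ_of_lt N i.2, ext_succ_of_lt N j.2] using h1

lemma summable_prod_pow {r : ℝ} (hr0 : 0 ≤ r) (hr : r < 1) (m : ℕ) :
    Summable fun N : Fin m → ℕ => ∏ i, r ^ N i := by
  induction m with
  | zero => exact Summable.of_finite
  | succ m ih =>
    rw [← (Fin.consEquiv fun _ => ℕ).summable_iff]
    refine ((summable_geometric_of_lt_one hr0 hr).mul_of_nonneg ih (fun s => ?_)
      fun N => ?_).congr fun x => ?_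
    · exact pow_nonneg hr0 s
    · exact Finset.prod_nonneg fun i _ => pow_nonneg hr0 _
    · simp [Fin.prod_univ_succ]

lemma summable_norm_chainTerm {q : ℂ} (hq : ‖q‖ < 1) {r : ℝ} (hr0 : 0 ≤ r) (hr : r < 1) (m : ℕ)
    {w : ℕ → ℕ → ℂ} (hw : ∀ i s, ‖w i s‖ ≤ r ^ s) :
    Summable fun N => ‖chainTerm q m w N‖ := by
  obtain ⟨K, hK0, hK⟩ := exists_norm_invPoch_le hq
  refine Summable.of_nonneg_of_le (fun N => norm_nonneg _) (fun N => ?_)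
    ((summable_prod_pow hr0 hr m).mul_right (K ^ m))
  have hprod : ∏ i ∈ Finset.range m, (r ^ ext m N (i + 1) * K) = (∏ i, r ^ N i) * K ^ m := by
    rw [Finset.prod_mul_distrib, Finset.prod_const, Finset.card_range, Finset.prod_range]
    congr 1
    exact Finset.prod_congr rfl fun i _ => by rw [ext_succ_of_lt N i.2]
  rw [chainTerm, norm_prod, ← hprod]
  refine Finset.prod_le_prod (fun i _ => norm_nonneg _) fun i _ => ?_
  rw [norm_mul]
  exact mul_le_mul (hw _ _) (hK _) (norm_nonneg _) (pow_nonneg hr0 _)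

/-- The multisum over chains starting at `n`. -/
noncomputable def chainSum (q : ℂ) (m : ℕ) (w : ℕ → ℕ → ℂ) (n : ℕ) : ℂ :=
  ∑' N : Fin m → ℕ, invPoch q ((n : ℤ) - ext m N 1) * chainTerm q m w N

lemma chainSum_zero (q : ℂ) (w : ℕ → ℕ → ℂ) (n : ℕ) : chainSum q 0 w n = invPoch q n := by
  simp [chainSum, chainTerm, _root_.ext]

lemma summable_invPoch_mul_chainTerm {q : ℂ} (hq : ‖q‖ < 1) {r : ℝ} (hr0 : 0 ≤ r) (hr : r < 1)
    (m : ℕ) {w : ℕ → ℕ → ℂ} (hw : ∀ i s, ‖w i s‖ ≤ r ^ s) (n : ℕ) :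
    Summable fun N : Fin m → ℕ => invPoch q ((n : ℤ) - ext m N 1) * chainTerm q m w N := by
  obtain ⟨K, hK0, hK⟩ := exists_norm_invPoch_le hq
  refine Summable.of_norm_bounded ((summable_norm_chainTerm hq hr0 hr m hw).mul_left K)
    fun N => ?_
  rw [norm_mul]
  exact mul_le_mul_of_nonneg_right (hK _) (norm_nonneg _)

lemma chainSum_succ {q : ℂ} (hq : ‖q‖ < 1) {r : ℝ} (hr0 : 0 ≤ r) (hr : r < 1) (m : ℕ)
    {w : ℕ → ℕ → ℂ} (hw : ∀ i s, ‖w i s‖ ≤ r ^ s) (n : ℕ) :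
    chainSum q (m + 1) w n = ∑ s ∈ Finset.range (n + 1),
      invPoch q (n - s) * w 0 s * chainSum q m (fun i => w (i + 1)) s := by
  have hs := summable_invPoch_mul_chainTerm hq hr0 hr (m + 1) hw n
  rw [← (Fin.consEquiv fun _ => ℕ).summable_iff] at hs
  rw [chainSum, ← (Fin.consEquiv fun _ => ℕ).tsum_eq]
  refine hs.tsum_prod.trans ?_
  rw [tsum_eq_sum (s := Finset.range (n + 1))]
  · refine Finset.sum_congr rfl fun s _ => ?_
    rw [chainSum, ← tsum_mul_left]
    refine tsum_congr fun N => ?_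
    change invPoch q ((n : ℤ) - ext (m + 1) (Fin.cons s N : Fin (m + 1) → ℕ) 1) *
      chainTerm q (m + 1) w (Fin.cons s N : Fin (m + 1) → ℕ) = _
    rw [ext_cons_one, chainTerm_cons]
    ring
  · intro s hs
    rw [Finset.mem_range] at hs
    refine (tsum_congr fun N => ?_).trans tsum_zero
    change invPoch q ((n : ℤ) - ext (m + 1) (Fin.cons s N : Fin (m + 1) → ℕ) 1) *
      chainTerm q (m + 1) w (Fin.cons s N : Fin (m + 1) → ℕ) = _
    rw [ext_cons_one, invPoch_of_neg q (by omega), zero_mul]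

lemma tendsto_chainSum {q : ℂ} (hq : ‖q‖ < 1) {r : ℝ} (hr0 : 0 ≤ r) (hr : r < 1)
    (m : ℕ) {w : ℕ → ℕ → ℂ} (hw : ∀ i s, ‖w i s‖ ≤ r ^ s) :
    Tendsto (chainSum q m w) atTop
      (𝓝 ((qPochInf q q)⁻¹ * ∑' N : Fin m → ℕ, chainTerm q m w N)) := by
  obtain ⟨K, hK0, hK⟩ := exists_norm_invPoch_le hq
  rw [← tsum_mul_left]
  refine tendsto_tsum_of_dominated_convergence
    ((summable_norm_chainTerm hq hr0 hr m hw).mul_left K) (fun N => ?_)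
    (Eventually.of_forall fun n N => ?_)
  · have h := tendsto_invPoch_add hq (-(ext m N 1 : ℤ))
    simp only [← sub_eq_add_neg] at h
    exact h.mul_const _
  · rw [norm_mul]
    exact mul_le_mul_of_nonneg_right (hK _) (norm_nonneg _)

/-- The weight `q^{s² + 2s}` at the positions `a, a + 2, …, k - 2` and `q^{s²}` elsewhere, where
position `i + 1` has index `i`. -/
noncomputable def andrewsWeight (k a : ℕ) (q : ℂ) (i s : ℕ) : ℂ :=
  q ^ (s ^ 2 + if a ≤ i + 1 ∧ i + 1 ≤ k - 2 ∧ (i + 1) % 2 = a % 2 then 2 * s else 0)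

lemma norm_andrewsWeight_le (k a : ℕ) {q : ℂ} (hq : ‖q‖ < 1) (i s : ℕ) :
    ‖andrewsWeight k a q i s‖ ≤ ‖q‖ ^ s := by
  rw [andrewsWeight, norm_pow]
  exact pow_le_pow_of_le_one (norm_nonneg q) hq.le
    ((Nat.le_self_pow two_ne_zero s).trans (Nat.le_add_right _ _))

lemma chainSum_andrewsWeight {q : ℂ} (hq0 : q ≠ 0) (hq : ‖q‖ < 1) (m a : ℕ) (ha : 1 ≤ a)
    (ham : a ≤ m + 1) (hpar : (m + 1) % 2 = a % 2) (n : ℕ) :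
    chainSum (q ^ 2) m (andrewsWeight (m + 1) a q) n = thetaSum q (m + 2) (m + 2 - a) n := by
  have hq2 : ‖q ^ 2‖ < 1 := by
    rw [norm_pow]
    exact pow_lt_one₀ (norm_nonneg q) hq two_ne_zero
  induction m generalizing a n with
  | zero =>
    obtain rfl : a = 1 := by omega
    rw [chainSum_zero, ← thetaSum_two_one hq0 hq2]
    norm_num
  | succ m ih =>
    rw [chainSum_succ hq2 (norm_nonneg q) hq m (norm_andrewsWeight_le _ _ hq)]
    obtain rfl | ha2 : a = 1 ∨ 2 ≤ a := by omega
    · have hw : (fun i => andrewsWeight (m + 1 + 1) 1 q (i + 1)) = andrewsWeight (m + 1) 2 q := by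
        funext i s
        simp only [andrewsWeight]
        congr 2
        exact if_congr (by omega) rfl rfl
      have hw0 : ∀ s, andrewsWeight (m + 1 + 1) 1 q 0 s = q ^ (s ^ 2) * q ^ (2 * s) := by
        intro s
        rw [andrewsWeight, if_pos (by omega), pow_add]
      simp only [hw, hw0, ih 2 (by norm_num) (by omega) (by omega)]
      have hA : ((m + 1 : ℕ) : ℤ) + 2 = ((m : ℤ) + 2) + 1 := by push_cast; ring
      rw [hA, show ((m : ℤ) + 2) + 1 - (1 : ℕ) = (m : ℤ) + 2 by push_cast; ring,
        ← sum_invPoch_mul_thetaSum hq0 hq2]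
      refine Finset.sum_congr rfl fun s _ => ?_
      rw [← pow_mul_thetaSum hq0 hq2]
      push_cast
      ring
    · have hw : (fun i => andrewsWeight (m + 1 + 1) a q (i + 1)) =
          andrewsWeight (m + 1) (a - 1) q := by
        funext i s
        simp only [andrewsWeight]
        congr 2
        exact if_congr (by omega) rfl rfl
      have hw0 : ∀ s, andrewsWeight (m + 1 + 1) a q 0 s = q ^ (s ^ 2) := by
        intro s
        rw [andrewsWeight, if_neg (by omega), add_zero]
      simp only [hw, hw0, ih (a - 1) (by omega) (by omega) (by omega)]
      rw [sum_invPoch_mul_thetaSum hq0 hq2]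
      congr 1
      omega

lemma andrewsTerm_eq_chainTerm (k a : ℕ) (ha : 1 ≤ a) (q : ℂ) {N : Fin (k - 1) → ℕ}
    (hN : Antitone N) :
    andrewsTerm k a q N = chainTerm (q ^ 2) (k - 1) (andrewsWeight k a q) N := by
  have hIcc : Finset.Icc 1 (k - 1) = (Finset.range (k - 1)).map (addRightEmbedding 1) := by
    ext i
    simp only [Finset.mem_Icc, Finset.mem_map, Finset.mem_range, addRightEmbedding_apply]
    exact ⟨fun h => ⟨i - 1, by omega, by omega⟩, by rintro ⟨j, hj, rfl⟩; omega⟩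
  have hfil : (Finset.Icc a (k - 2)).filter (fun i => i % 2 = a % 2) =
      (Finset.Icc 1 (k - 1)).filter (fun i => a ≤ i ∧ i ≤ k - 2 ∧ i % 2 = a % 2) := by
    ext i
    simp only [Finset.mem_filter, Finset.mem_Icc]
    omega
  rw [andrewsTerm, hfil, Finset.sum_filter, ← Finset.sum_add_distrib, hIcc, Finset.sum_map,
    Finset.prod_map, ← Finset.prod_pow_eq_pow_sum, div_eq_mul_inv, ← Finset.prod_inv_distrib,
    ← Finset.prod_mul_distrib, chainTerm]
  refine Finset.prod_congr rfl fun i hi => ?_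
  rw [Finset.mem_range] at hi
  simp only [addRightEmbedding_apply]
  have hle : ext (k - 1) N (i + 1 + 1) ≤ ext (k - 1) N (i + 1) := by
    rcases lt_or_ge (i + 1) (k - 1) with h | h
    · rw [ext_succ_of_lt N h, ext_succ_of_lt N hi]
      exact hN (Fin.mk_le_mk.mpr i.le_succ)
    · rw [ext_succ_of_le N h]
      exact Nat.zero_le _
  rw [← Nat.cast_sub hle, invPoch_natCast]
  rfl

lemma summable_pow_natAbs {r : ℝ} (hr0 : 0 ≤ r) (hr : r < 1) :
    Summable fun j : ℤ => r ^ j.natAbs :=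
  Summable.of_nat_of_neg (by simpa using summable_geometric_of_lt_one hr0 hr)
    (by simpa using summable_geometric_of_lt_one hr0 hr)

lemma summable_norm_theta {q : ℂ} (hq0 : q ≠ 0) (hq : ‖q‖ < 1) {A B : ℤ} (hB : 0 ≤ B)
    (hBA : B < A) : Summable fun j : ℤ => ‖(-1) ^ j * q ^ (A * j ^ 2 - B * j)‖ := by
  refine Summable.of_nonneg_of_le (fun j => norm_nonneg _) (fun j => ?_)
    (summable_pow_natAbs (norm_nonneg q) hq)
  rw [norm_mul, norm_zpow, norm_zpow, norm_neg, norm_one, one_zpow, one_mul, ← zpow_natCast]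
  refine zpow_le_zpow_right_of_le_one₀ (norm_pos_iff.mpr hq0) hq.le ?_
  rw [Int.natCast_natAbs]
  have h1 : |j| ≤ j ^ 2 := by
    rw [← sq_abs]
    exact Int.le_self_sq _
  nlinarith [le_abs_self j, abs_nonneg j]

lemma andrewsTerm_zero_eq_zero (k a : ℕ) {N : Fin (k - 1) → ℕ} (hN : N ≠ 0) :
    andrewsTerm k a 0 N = 0 := by
  obtain ⟨i, hi⟩ := Function.ne_iff.mp hN
  have hpos : 0 < ∑ i ∈ Finset.Icc 1 (k - 1), (ext (k - 1) N i) ^ 2 := by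
    refine Finset.sum_pos' (fun _ _ => Nat.zero_le _)
      ⟨i + 1, Finset.mem_Icc.mpr (by omega), ?_⟩
    rw [ext_succ_of_lt N i.2]
    exact pow_pos (Nat.pos_of_ne_zero hi) 2
  rw [andrewsTerm, zero_pow (by omega), zero_div]

lemma andrewsTerm_apply_zero (k a : ℕ) (q : ℂ) : andrewsTerm k a q 0 = 1 := by
  simp [andrewsTerm, _root_.ext, qPoch_zero]

/-- Andrews' product-multisum identity in the case `k ≡ a (mod 2)`. -/
theorem andrews_same_parity_multisum (k a : ℕ) (hk : 2 ≤ k) (ha : 1 ≤ a) (hak : a ≤ k)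
    (hpar : k % 2 = a % 2) (q : ℂ) (hq : ‖q‖ < 1) :
    Summable (fun N : {N : Fin (k - 1) → ℕ // Antitone N} => andrewsTerm k a q N.1) ∧
    qPochInf (q ^ 2) (-q) * qPochInf (q ^ (2 * k + 2)) (q ^ a) *
        qPochInf (q ^ (2 * k + 2)) (q ^ (2 * k + 2 - a)) *
        qPochInf (q ^ (2 * k + 2)) (q ^ (2 * k + 2)) / qPochInf (q ^ 2) (q ^ 2) =
      ∑' N : {N : Fin (k - 1) → ℕ // Antitone N}, andrewsTerm k a q N.1 := by
  have hsupp : Function.support (chainTerm (q ^ 2) (k - 1) (andrewsWeight k a q)) ⊆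
      {N | Antitone N} := fun N hN => antitone_of_chainTerm_ne_zero hN
  have hterm : (fun N : {N : Fin (k - 1) → ℕ // Antitone N} => andrewsTerm k a q N.1) =
      fun N => chainTerm (q ^ 2) (k - 1) (andrewsWeight k a q) N.1 :=
    funext fun N => andrewsTerm_eq_chainTerm k a ha q N.2
  have hq2 : ‖q ^ 2‖ < 1 := by
    rw [norm_pow]
    exact pow_lt_one₀ (norm_nonneg q) hq two_ne_zero
  have hsum : Summable (chainTerm (q ^ 2) (k - 1) (andrewsWeight k a q)) :=
    (summable_norm_chainTerm hq2 (norm_nonneg q) hq (k - 1)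
      (norm_andrewsWeight_le k a hq)).of_norm
  refine ⟨?_, ?_⟩
  · rw [hterm]
    exact hsum.subtype {N | Antitone N}
  rcases eq_or_ne q 0 with rfl | hq0
  · rw [tsum_eq_single ⟨0, antitone_const⟩ fun N hN =>
      andrewsTerm_zero_eq_zero k a fun h => hN (Subtype.ext h)]
    rw [andrewsTerm_apply_zero]
    have h1 : ∀ x, qPochInf x 0 = 1 := fun x => by simp [qPochInf]
    rw [zero_pow (show 2 * k + 2 ≠ 0 by omega), zero_pow (show a ≠ 0 by omega),
      zero_pow (show 2 * k + 2 - a ≠ 0 by omega), zero_pow two_ne_zero, neg_zero, h1]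
    norm_num
  have hchain : ∑' N : {N : Fin (k - 1) → ℕ // Antitone N}, andrewsTerm k a q N.1 =
      ∑' N, chainTerm (q ^ 2) (k - 1) (andrewsWeight k a q) N := by
    rw [hterm]
    exact tsum_subtype_eq_of_support_subset hsupp
  obtain ⟨m, rfl⟩ : ∃ m, k = m + 1 := ⟨k - 1, by omega⟩
  change _ = ∑' N : Fin m → ℕ, chainTerm (q ^ 2) m (andrewsWeight (m + 1) a q) N at hchain
  have hs := summable_norm_theta hq0 hq (A := m + 2) (B := m + 2 - a) (by omega) (by omega)
  have hlim := tendsto_chainSum hq2 (norm_nonneg q) hq m (norm_andrewsWeight_le (m + 1) a hq)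
  have heq := tendsto_nhds_unique hlim ((tendsto_thetaSum hq2 _ _ hs).congr fun n =>
    (chainSum_andrewsWeight hq0 hq m a ha hak hpar n).symm)
  have hmono : ∀ j : ℤ, (-1 : ℂ) ^ j * q ^ (((m : ℤ) + 2) * j ^ 2 - ((m : ℤ) + 2 - a) * j) =
      (-1) ^ j * (q ^ a) ^ j * (q ^ (m + 2)) ^ (j ^ 2 - j) := by
    intro j
    rw [← zpow_natCast q a, ← zpow_natCast q (m + 2), ← zpow_mul, ← zpow_mul, mul_assoc,
      ← zpow_add₀ hq0]
    congr 2
    push_cast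
    ring
  simp only [hmono] at heq hs
  have hbase : (q ^ (m + 2)) ^ 2 = q ^ (2 * (m + 1) + 2) := by ring
  have hp1 : ‖(q ^ (m + 2)) ^ 2‖ < 1 := by
    rw [hbase, norm_pow]
    exact pow_lt_one₀ (norm_nonneg q) hq (by omega)
  have hdiv : (q ^ (m + 2)) ^ 2 / q ^ a = q ^ (2 * (m + 1) + 2 - a) := by
    rw [hbase, div_eq_iff (pow_ne_zero _ hq0), ← pow_add, Nat.sub_add_cancel (by omega)]
  rw [jacobi_triple_product (pow_ne_zero _ hq0) hp1 (pow_ne_zero _ hq0) hs, hdiv, hbase,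
    ← hchain] at heq
  have hne := qPochInf_self_ne_zero hq2
  field_simp at heq ⊢
  linear_combination -heq
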